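/- arXiv:2404.03886 — 2 statements merged into one kernel-verified Lean document; each statement's English description precedes it below -/
import Mathlib

section
/- Let V be a real normed vector space and η : V → V a locally Lipschitz, even map (η(-x) = η(x) for all x). Let σ : V → V be a continuous linear map commuting with η (σ (η x) = η (σ x) for all x). Let s ∈ ℝ, r > 0, and let c : ℝ → V be differentiable on the open interval (s - r, s + r) with deriv c t = -η (c t) for all t ∈ (s - r, s + r). If σ (c s) = -(c s), then σ (c (s + t)) = -c(s - t) for all t ∈ (-r, r). (This is identity (011) in the proof of Theorem 1.6, obtained from uniqueness of integral curves of -η.) -/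
open Filter Set Topology

/-- Two integral curves of a locally Lipschitz vector field which agree at one point agree near
that point. -/
theorem LocallyLipschitz.eventuallyEq_of_hasDerivAt {E : Type*} [NormedAddCommGroup E]
    [NormedSpace ℝ E] {v : E → E} (hv : LocallyLipschitz v) {f g : ℝ → E} {t₀ : ℝ}
    (hf : ∀ᶠ t in 𝓝 t₀, HasDerivAt f (v (f t)) t)
    (hg : ∀ᶠ t in 𝓝 t₀, HasDerivAt g (v (g t)) t) (heq : f t₀ = g t₀) :
    f =ᶠ[𝓝 t₀] g := by
  obtain ⟨K, U, hU, hK⟩ := hv (f t₀)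
  exact ODE_solution_unique_of_eventually (v := fun _ ↦ v) (s := fun _ ↦ U)
    (Eventually.of_forall fun _ ↦ hK)
    (hf.and (hf.self_of_nhds.continuousAt hU))
    (hg.and (hg.self_of_nhds.continuousAt (heq ▸ hU))) heq

/-- Two integral curves of a locally Lipschitz vector field on a preconnected open set which agree
at one point agree on the whole set. -/
theorem LocallyLipschitz.eqOn_of_hasDerivAt {E : Type*} [NormedAddCommGroup E]
    [NormedSpace ℝ E] {v : E → E} (hv : LocallyLipschitz v) {J : Set ℝ} (hJ : IsOpen J)
    (hJ' : IsPreconnected J) {f g : ℝ → E} (hf : ∀ t ∈ J, HasDerivAt f (v (f t)) t)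
    (hg : ∀ t ∈ J, HasDerivAt g (v (g t)) t) {t₀ : ℝ} (ht₀ : t₀ ∈ J) (heq : f t₀ = g t₀) :
    EqOn f g J := by
  have eventuallyEq {t : ℝ} (ht : t ∈ J) (h : f t = g t) : f =ᶠ[𝓝 t] g :=
    hv.eventuallyEq_of_hasDerivAt (eventually_of_mem (hJ.mem_nhds ht) hf)
      (eventually_of_mem (hJ.mem_nhds ht) hg) h
  have hsub : J ⊆ {t | f =ᶠ[𝓝 t] g} := by
    refine hJ'.subset_of_closure_inter_subset isOpen_setOfPred_eventually_nhds
      ⟨t₀, ht₀, eventuallyEq ht₀ heq⟩ ?_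
    rintro t ⟨htc, ht⟩
    exact eventuallyEq ht <| tendsto_nhds_unique_of_frequently_eq (hf t ht).continuousAt
      (hg t ht).continuousAt
      ((mem_closure_iff_frequently.mp htc).mono fun _ h ↦ h.self_of_nhds)
  exact fun t ht ↦ (hsub ht).self_of_nhds

/-- Identity (011) in the proof of Theorem 1.6: if `η` is locally Lipschitz and even,
`σ` is a continuous linear map commuting with `η`, and `c` is an integral curve of
`-η` on `(s - r, s + r)` with `σ (c s) = -(c s)`, then
`σ (c (s + t)) = -c (s - t)` for all `t ∈ (-r, r)`. -/
theorem symmetric_integral_curve_identity (V : Type*) [NormedAddCommGroup V]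
    [NormedSpace ℝ V]
    (η : V → V) (hlip : LocallyLipschitz η) (heven : ∀ x : V, η (-x) = η x)
    (σ : V →L[ℝ] V) (hcomm : ∀ x : V, σ (η x) = η (σ x))
    (s r : ℝ) (hr : 0 < r) (c : ℝ → V)
    (hdiff : ∀ t ∈ Set.Ioo (s - r) (s + r), DifferentiableAt ℝ c t)
    (hderiv : ∀ t ∈ Set.Ioo (s - r) (s + r), deriv c t = -η (c t))
    (hσ : σ (c s) = -(c s)) :
    ∀ t ∈ Set.Ioo (-r) r, σ (c (s + t)) = -c (s - t) := by
  have hc : ∀ t ∈ Ioo (s - r) (s + r), HasDerivAt c (-η (c t)) t := fun t ht ↦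
    hderiv t ht ▸ (hdiff t ht).hasDerivAt
  have hneg : LocallyLipschitz fun x ↦ -η x := LipschitzWith.id.neg.locallyLipschitz.comp hlip
  refine hneg.eqOn_of_hasDerivAt isOpen_Ioo isPreconnected_Ioo (f := fun t ↦ σ (c (s + t)))
    (g := fun t ↦ -c (s - t)) (fun t ht ↦ ?_) (fun t ht ↦ ?_) (t₀ := 0)
    ⟨neg_lt_zero.mpr hr, hr⟩ (by simpa using hσ)
  · have h := (hc (s + t) ⟨by linarith [ht.1], by linarith [ht.2]⟩).comp_const_add s t
    simpa [hcomm, Function.comp_def] using σ.hasFDerivAt.comp_hasDerivAt t h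
  · have h := (hc (s - t) ⟨by linarith [ht.2], by linarith [ht.1]⟩).comp_const_sub s t
    simpa [heven] using h.fun_neg
end

section
/- Let V be a real normed vector space and let Γ be a subgroup of the group of continuous linear automorphisms of V. Let η : V → V be a locally Lipschitz map that is even (η(-x) = η(x) for all x) and Γ-equivariant (η(σ x) = σ (η x) for all σ ∈ Γ and x ∈ V), and suppose that for every x ∈ V there exists σ ∈ Γ with σ x = -x. Let t₁ ∈ ℝ and let c : ℝ → V be differentiable on an open interval I containing 0 and t₁, with deriv c t = -η (c t) for all t ∈ I. Then there exists τ ∈ Γ such that c t₁ = τ (c 0). In other words, every integral curve of -η stays in a single Γ-orbit. (This is the analytic core of Theorem 1.6: a weakly symmetric spray manifold with a reductive decomposition is geodesic orbit; here Γ plays the role of Ad(H) acting on 𝔪 and η is the spray vector field.) -/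
open Set in
/-- Two solutions of an autonomous ODE with locally Lipschitz right-hand side that agree at an
interior point of a compact interval agree on the whole interval. -/
theorem LocallyLipschitz.eqOn_Icc_of_hasDerivAt {E : Type*} [NormedAddCommGroup E]
    [NormedSpace ℝ E] {v : E → E} (hv : LocallyLipschitz v) {f g : ℝ → E} {a b t₀ : ℝ}
    (ht₀ : t₀ ∈ Ioo a b) (hf : ∀ t ∈ Icc a b, HasDerivAt f (v (f t)) t)
    (hg : ∀ t ∈ Icc a b, HasDerivAt g (v (g t)) t) (heq : f t₀ = g t₀) :
    EqOn f g (Icc a b) := by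
  have hfc : ContinuousOn f (Icc a b) := fun t ht ↦ (hf t ht).continuousAt.continuousWithinAt
  have hgc : ContinuousOn g (Icc a b) := fun t ht ↦ (hg t ht).continuousAt.continuousWithinAt
  obtain ⟨K, hK⟩ := (hv.locallyLipschitzOn (s := f '' Icc a b ∪ g '' Icc a b))
    |>.exists_lipschitzOnWith_of_compact
      ((isCompact_Icc.image_of_continuousOn hfc).union (isCompact_Icc.image_of_continuousOn hgc))
  exact ODE_solution_unique_of_mem_Icc (v := fun _ ↦ v) (fun _ _ ↦ hK) ht₀
    hfc (fun t ht ↦ hf t (Ioo_subset_Icc_self ht))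
    (fun t ht ↦ .inl (mem_image_of_mem f (Ioo_subset_Icc_self ht)))
    hgc (fun t ht ↦ hg t (Ioo_subset_Icc_self ht))
    (fun t ht ↦ .inr (mem_image_of_mem g (Ioo_subset_Icc_self ht))) heq

/-- The analytic core of Theorem 1.6 (a weakly symmetric spray manifold with a
reductive decomposition is geodesic orbit): if `η` is locally Lipschitz, even and
`Γ`-equivariant for a subgroup `Γ` of continuous linear automorphisms of `V`, and
every `x` can be sent to `-x` by some element of `Γ`, then every integral curve of
`-η` stays in a single `Γ`-orbit. -/
theorem integral_curve_stays_in_orbit (V : Type*) [NormedAddCommGroup V]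
    [NormedSpace ℝ V]
    (Γ : Subgroup (V ≃L[ℝ] V))
    (η : V → V) (hlip : LocallyLipschitz η) (heven : ∀ x : V, η (-x) = η x)
    (hequiv : ∀ σ ∈ Γ, ∀ x : V, η (σ x) = σ (η x))
    (hsym : ∀ x : V, ∃ σ ∈ Γ, σ x = -x)
    (t₁ a b : ℝ) (h0 : (0 : ℝ) ∈ Set.Ioo a b) (ht₁ : t₁ ∈ Set.Ioo a b)
    (c : ℝ → V)
    (hdiff : ∀ t ∈ Set.Ioo a b, DifferentiableAt ℝ c t)
    (hderiv : ∀ t ∈ Set.Ioo a b, deriv c t = -η (c t)) :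
    ∃ τ ∈ Γ, c t₁ = τ (c 0) := by
  have hc : ∀ t ∈ Set.Ioo a b, HasDerivAt c (-η (c t)) t := fun t ht ↦
    hderiv t ht ▸ (hdiff t ht).hasDerivAt
  rcases eq_or_ne t₁ 0 with rfl | hne
  · exact ⟨1, Γ.one_mem, rfl⟩
  obtain ⟨σ, hσ, hσc⟩ := hsym (c (t₁ / 2))
  obtain ⟨ρ, hρ, hρc⟩ := hsym (c 0)
  have hv : LocallyLipschitz fun x ↦ -η x := fun x ↦
    let ⟨K, s, hs, hK⟩ := hlip x
    ⟨K, s, hs, hK.neg⟩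
  have hmid : t₁ / 2 ∈ Set.Ioo (min 0 t₁) (max 0 t₁) := by
    rcases lt_or_gt_of_ne hne with h | h
    · rw [min_eq_right h.le, max_eq_left h.le]; constructor <;> linarith
    · rw [min_eq_left h.le, max_eq_right h.le]; constructor <;> linarith
  have hmem : ∀ t ∈ Set.Icc (min 0 t₁) (max 0 t₁), t ∈ Set.Ioo a b := fun t ht ↦
    ⟨(lt_min h0.1 ht₁.1).trans_le ht.1, ht.2.trans_lt (max_lt h0.2 ht₁.2)⟩
  have hrefl : ∀ t ∈ Set.Icc (min 0 t₁) (max 0 t₁),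
      t₁ - t ∈ Set.Icc (min 0 t₁) (max 0 t₁) := by
    intro t ht
    have := min_add_max 0 t₁
    constructor <;> linarith [ht.1, ht.2]
  have hcurve : ∀ t ∈ Set.Icc (min 0 t₁) (max 0 t₁),
      HasDerivAt (fun t ↦ -σ (c (t₁ - t))) (-η (-σ (c (t₁ - t)))) t := by
    intro t ht
    have h := HasDerivAt.comp_const_sub t₁ t (hc _ (hmem _ (hrefl t ht)))
    have h' := ((σ : V →L[ℝ] V).hasFDerivAt.comp_hasDerivAt t h).neg
    rw [heven, hequiv σ hσ]
    simpa [Function.comp_def, Pi.neg_def] using h'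
  have heq := hv.eqOn_Icc_of_hasDerivAt hmid (fun t ht ↦ hc t (hmem t ht)) hcurve
    (by simp [show t₁ - t₁ / 2 = t₁ / 2 by ring, hσc])
  refine ⟨σ * ρ, Γ.mul_mem hσ hρ, ?_⟩
  have h := heq (x := t₁) ⟨min_le_right _ _, le_max_right _ _⟩
  change c t₁ = σ (ρ (c 0))
  rw [hρc, map_neg]
  simpa using h
end
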